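/- arXiv:1310.4432 — 8 statements merged into one kernel-verified Lean document; each statement's English description precedes it below -/
import Mathlib

section
/- Let K be a field of characteristic 0, g a finite-dimensional Lie algebra over K, h ⊆ g a Lie subalgebra, and ω a nondegenerate alternating bilinear form on g/h. Then there exists a symplectic connection on (g,h,ω) — a K-bilinear map ∇ : g × (g/h) → g/h with ∇_a p(y) = p([a,y]) for all a ∈ h and y ∈ g, with ∇_x p(y) − ∇_y p(x) = p([x,y]) for all x,y ∈ g, and with ω(∇_x b, b') + ω(b, ∇_x b') = 0 for all x ∈ g, b,b' ∈ g/h — if and only if ω(p[x,y],p(z)) + ω(p[y,z],p(x)) + ω(p[z,x],p(y)) = 0 for all x,y,z ∈ g. -/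
/-- A nondegenerate alternating form `ω` for which the alternating product `M` is closed admits
a product `S` by infinitesimally symplectic operators whose commutator is `M`. -/
theorem exists_skew_product_of_closed {K V : Type*} [Field K] [CharZero K] [AddCommGroup V]
    [Module K V] [FiniteDimensional K V] (ω : V →ₗ[K] V →ₗ[K] K) (halt : ∀ b, ω b b = 0)
    (hnd : ∀ b, (∀ b', ω b b' = 0) → b = 0) (M : V →ₗ[K] V →ₗ[K] V) (hM : ∀ v, M v v = 0)
    (hclosed : ∀ u v w, ω (M u v) w + ω (M v w) u + ω (M w u) v = 0) :
    ∃ S : V →ₗ[K] V →ₗ[K] V, (∀ u v, S u v - S v u = M u v) ∧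
      ∀ u v w, ω (S u v) w + ω v (S u w) = 0 := by
  have hω : ∀ u v, ω u v = -ω v u := fun u v => (LinearMap.IsAlt.neg halt v u).symm
  have hMneg : ∀ u v, M v u = -M u v := fun u v => by
    have := hM (u + v)
    simp only [map_add, LinearMap.add_apply, hM, zero_add, add_zero] at this
    exact eq_neg_of_add_eq_zero_left this
  have hinj : Function.Injective ω := (injective_iff_map_eq_zero ω).2 fun b hb =>
    hnd b fun b' => by rw [hb, LinearMap.zero_apply]
  let e : V ≃ₗ[K] Module.Dual K V :=
    LinearEquiv.ofInjectiveOfFinrankEq ω hinj Subspace.dual_finrank_eq.symm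
  have he : ∀ f v, ω (e.symm f) v = f v := fun f v => LinearMap.congr_fun (e.apply_symm_apply f) v
  let T : V →ₗ[K] V →ₗ[K] Module.Dual K V := LinearMap.mk₂ K
    (fun u v => (-6⁻¹ : K) • (ω v ∘ₗ M u + ω u ∘ₗ M v))
    (fun _ _ _ => by ext; simp; ring) (fun _ _ _ => by ext; simp; ring)
    (fun _ _ _ => by ext; simp; ring) (fun _ _ _ => by ext; simp; ring)
  have hT : ∀ u v w, T u v w = (-6⁻¹ : K) * (ω v (M u w) + ω u (M v w)) := fun _ _ _ => rfl
  have hTsymm : ∀ u v, T u v = T v u := fun u v => by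
    ext w
    rw [hT, hT, add_comm]
  refine ⟨(2⁻¹ : K) • M + T.compr₂ e.symm.toLinearMap, fun u v => ?_, fun u v w => ?_⟩
  · simp only [LinearMap.add_apply, LinearMap.smul_apply, LinearMap.compr₂_apply,
      LinearEquiv.coe_coe, hTsymm v u, hMneg u v]
    module
  · have hc := hclosed u v w
    simp only [LinearMap.add_apply, LinearMap.smul_apply, LinearMap.compr₂_apply,
      LinearEquiv.coe_coe, map_add, map_smul, smul_eq_mul, he, hω v (e.symm _), hT]
    rw [hMneg u w, hω (M v w) u, map_neg, LinearMap.neg_apply, hω (M u w) v] at hc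
    rw [hMneg v w, hω (M u v) w, map_neg]
    rw [hω (M u v) w] at hc
    linear_combination (1 / 3 : K) * hc


theorem stmt2 {K : Type*} [Field K] [CharZero K]
    {g : Type*} [LieRing g] [LieAlgebra K g] [FiniteDimensional K g]
    (h : LieSubalgebra K g)
    (ω : (g ⧸ h.toSubmodule) →ₗ[K] (g ⧸ h.toSubmodule) →ₗ[K] K)
    (halt : ∀ b, ω b b = 0)
    (hnd : ∀ b, (∀ b', ω b b' = 0) → b = 0) :
    (∃ D : g →ₗ[K] (g ⧸ h.toSubmodule) →ₗ[K] (g ⧸ h.toSubmodule),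
        (∀ a ∈ h, ∀ y : g, D a (h.toSubmodule.mkQ y) = h.toSubmodule.mkQ ⁅a, y⁆) ∧
        (∀ x y : g, D x (h.toSubmodule.mkQ y) - D y (h.toSubmodule.mkQ x) = h.toSubmodule.mkQ ⁅x, y⁆) ∧
        (∀ x : g, ∀ b b', ω (D x b) b' + ω b (D x b') = 0)) ↔
      (∀ x y z : g,
        ω (h.toSubmodule.mkQ ⁅x, y⁆) (h.toSubmodule.mkQ z) + ω (h.toSubmodule.mkQ ⁅y, z⁆) (h.toSubmodule.mkQ x) + ω (h.toSubmodule.mkQ ⁅z, x⁆) (h.toSubmodule.mkQ y) = 0) := by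
  have hω : ∀ u v, ω u v = -ω v u := fun u v => (LinearMap.IsAlt.neg halt v u).symm
  constructor
  · rintro ⟨D, -, htf, hD⟩ x y z
    simp only [← htf, map_sub, LinearMap.sub_apply]
    have h₁ := hD x (h.toSubmodule.mkQ y) (h.toSubmodule.mkQ z)
    have h₂ := hD y (h.toSubmodule.mkQ z) (h.toSubmodule.mkQ x)
    have h₃ := hD z (h.toSubmodule.mkQ x) (h.toSubmodule.mkQ y)
    rw [hω (h.toSubmodule.mkQ _)] at h₁ h₂ h₃
    linear_combination h₁ + h₂ + h₃
  · intro hclosed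
    set p := h.toSubmodule.mkQ with hp
    have hp0 : ∀ a, p a = 0 ↔ a ∈ h := fun a => by simp [hp]
    obtain ⟨s, hs⟩ := p.exists_rightInverse_of_surjective
      (LinearMap.range_eq_top.2 h.toSubmodule.mkQ_surjective)
    replace hs : ∀ b, p (s b) = b := fun b => LinearMap.congr_fun hs b
    have hker : ∀ x, x - s (p x) ∈ h := fun x => by rw [← hp0, map_sub, hs, sub_self]
    have hlie : ∀ a ∈ h, ∀ y, p ⁅a, s (p y)⁆ = p ⁅a, y⁆ := fun a ha y => by
      have := (hp0 _).2 (h.lie_mem ha (hker y))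
      rw [lie_sub, map_sub, sub_eq_zero] at this
      exact this.symm
    let M : (g ⧸ h.toSubmodule) →ₗ[K] (g ⧸ h.toSubmodule) →ₗ[K] (g ⧸ h.toSubmodule) :=
      LinearMap.mk₂ K (fun u v => p ⁅s u, s v⁆)
        (fun _ _ _ => by simp only [map_add, add_lie])
        (fun _ _ _ => by simp only [map_smul, smul_lie])
        (fun _ _ _ => by simp only [map_add, lie_add])
        (fun _ _ _ => by simp only [map_smul, lie_smul])
    have hM : ∀ u v, M u v = p ⁅s u, s v⁆ := fun _ _ => rfl
    obtain ⟨S, hSM, hSω⟩ := exists_skew_product_of_closed ω halt hnd M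
      (fun v => by rw [hM, lie_self, map_zero])
      (fun u v w => by simpa only [hM, hs] using hclosed (s u) (s v) (s w))
    let D : g →ₗ[K] (g ⧸ h.toSubmodule) →ₗ[K] (g ⧸ h.toSubmodule) :=
      LinearMap.mk₂ K (fun x b => p ⁅x - s (p x), s b⁆ + S (p x) b)
        (fun _ _ _ => by
          simp only [map_add, LinearMap.add_apply, add_lie, sub_lie, map_sub]; abel)
        (fun _ _ _ => by
          simp only [map_smul, LinearMap.smul_apply, smul_lie, ← smul_sub, smul_add])
        (fun _ _ _ => by simp only [map_add, lie_add]; abel)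
        (fun _ _ _ => by simp only [map_smul, lie_smul, smul_add])
    have hD : ∀ x b, D x b = p ⁅x - s (p x), s b⁆ + S (p x) b := fun _ _ => rfl
    refine ⟨D, fun a ha y => ?_, fun x y => ?_, fun x b b' => ?_⟩
    · rw [hD, (hp0 a).2 ha, map_zero, map_zero, LinearMap.zero_apply, add_zero, sub_zero,
        hlie a ha]
    · have hS := hSM (p x) (p y)
      have hx := hlie _ (hker x) y
      rw [hM] at hS
      rw [hD, hD, add_sub_add_comm, hS, hx, ← map_sub, ← map_add, sub_lie, sub_lie,
        ← lie_skew y (s (p x)), ← lie_skew (s (p y)) (s (p x))]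
      congr 1
      abel
    · have hinv := hclosed (x - s (p x)) (s b) (s b')
      rw [(hp0 _).2 (hker x), map_zero, add_zero, hs, hs, ← lie_skew (s b'), map_neg, map_neg,
        LinearMap.neg_apply, hω _ b, neg_neg] at hinv
      rw [hD, hD, map_add, map_add, LinearMap.add_apply]
      linear_combination hinv + hSω (p x) b b'
end

section
/- Let (g,h,ω) be a symplectic Lie pair of Lie algebras over a field K and ∇ a symplectic connection on it, with curvature R(x,y) = ∇_x∘∇_y − ∇_y∘∇_x − ∇_{[x,y]}. Then for every a ∈ h the expression ω(R(a,x) p(y), p(z)) depends only on p(x), p(y), p(z), and the resulting trilinear form on g/h is totally symmetric: ω(R(a,x)p(y), p(z)) = ω(R(a,y)p(x), p(z)) and ω(R(a,x)p(y), p(z)) = ω(R(a,x)p(z), p(y)) for all x,y,z ∈ g. -/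
/-- Curvature of a connection `D` on a Lie pair:
`R(x,y) = D_x ∘ D_y - D_y ∘ D_x - D_[x,y]`. -/
def curv {K : Type*} [Field K] {g : Type*} [LieRing g] [LieAlgebra K g]
    {Q : Type*} [AddCommGroup Q] [Module K Q]
    (D : g →ₗ[K] Q →ₗ[K] Q) (x y : g) (b : Q) : Q :=
  D x (D y b) - D y (D x b) - D ⁅x, y⁆ b

/-- The algebraic Bianchi identity for a torsion-free connection on a Lie pair extending the
`h`-action, with one argument in `h`. -/
theorem curv_mkQ_comm {K : Type*} [Field K] {g : Type*} [LieRing g] [LieAlgebra K g]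
    (h : LieSubalgebra K g)
    (D : g →ₗ[K] (g ⧸ h.toSubmodule) →ₗ[K] (g ⧸ h.toSubmodule))
    (hDext : ∀ a ∈ h, ∀ y : g, D a (h.toSubmodule.mkQ y) = h.toSubmodule.mkQ ⁅a, y⁆)
    (hDtf : ∀ x y : g,
      D x (h.toSubmodule.mkQ y) - D y (h.toSubmodule.mkQ x) = h.toSubmodule.mkQ ⁅x, y⁆)
    {a : g} (ha : a ∈ h) (x y : g) :
    curv D a x (h.toSubmodule.mkQ y) = curv D a y (h.toSubmodule.mkQ x) := by
  have hxy : D a (D x (h.toSubmodule.mkQ y)) - D a (D y (h.toSubmodule.mkQ x))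
      = h.toSubmodule.mkQ ⁅⁅a, x⁆, y⁆ + h.toSubmodule.mkQ ⁅x, ⁅a, y⁆⁆ := by
    rw [← map_sub, hDtf, hDext a ha, leibniz_lie, map_add]
  rw [← hDtf ⁅a, x⁆ y, ← hDtf x ⁅a, y⁆] at hxy
  simp only [curv, hDext a ha]
  rw [← sub_eq_zero] at hxy ⊢
  rw [← hxy]
  abel

/-- The curvature of a connection preserving `ω` is skew with respect to `ω`. -/
theorem curv_skew {K : Type*} [Field K] {g : Type*} [LieRing g] [LieAlgebra K g]
    {Q : Type*} [AddCommGroup Q] [Module K Q] (ω : Q →ₗ[K] Q →ₗ[K] K)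
    (D : g →ₗ[K] Q →ₗ[K] Q)
    (hDpar : ∀ x : g, ∀ b b', ω (D x b) b' + ω b (D x b') = 0) (x y : g) (b b' : Q) :
    ω (curv D x y b) b' + ω b (curv D x y b') = 0 := by
  simp only [curv, map_sub, LinearMap.sub_apply]
  linear_combination hDpar x (D y b) b' - hDpar y (D x b) b' - hDpar ⁅x, y⁆ b b'
    - hDpar y b (D x b') + hDpar x b (D y b')

theorem stmt4 {K : Type*} [Field K] {g : Type*} [LieRing g] [LieAlgebra K g]
    (h : LieSubalgebra K g)
    (ω : (g ⧸ h.toSubmodule) →ₗ[K] (g ⧸ h.toSubmodule) →ₗ[K] K)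
    (halt : ∀ b, ω b b = 0)
    (hnd : ∀ b, (∀ b', ω b b' = 0) → b = 0)
    (hclosed : ∀ x y z : g,
      ω (h.toSubmodule.mkQ ⁅x, y⁆) (h.toSubmodule.mkQ z) + ω (h.toSubmodule.mkQ ⁅y, z⁆) (h.toSubmodule.mkQ x) + ω (h.toSubmodule.mkQ ⁅z, x⁆) (h.toSubmodule.mkQ y) = 0)
    (D : g →ₗ[K] (g ⧸ h.toSubmodule) →ₗ[K] (g ⧸ h.toSubmodule))
    (hDext : ∀ a ∈ h, ∀ y : g, D a (h.toSubmodule.mkQ y) = h.toSubmodule.mkQ ⁅a, y⁆)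
    (hDtf : ∀ x y : g, D x (h.toSubmodule.mkQ y) - D y (h.toSubmodule.mkQ x) = h.toSubmodule.mkQ ⁅x, y⁆)
    (hDpar : ∀ x : g, ∀ b b', ω (D x b) b' + ω b (D x b') = 0) :
    ∀ a ∈ h,
      (∀ x x' y y' z z' : g, h.toSubmodule.mkQ x = h.toSubmodule.mkQ x' → h.toSubmodule.mkQ y = h.toSubmodule.mkQ y' → h.toSubmodule.mkQ z = h.toSubmodule.mkQ z' →
        ω (curv D a x (h.toSubmodule.mkQ y)) (h.toSubmodule.mkQ z) = ω (curv D a x' (h.toSubmodule.mkQ y')) (h.toSubmodule.mkQ z')) ∧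
      (∀ x y z : g,
        ω (curv D a x (h.toSubmodule.mkQ y)) (h.toSubmodule.mkQ z) = ω (curv D a y (h.toSubmodule.mkQ x)) (h.toSubmodule.mkQ z) ∧
        ω (curv D a x (h.toSubmodule.mkQ y)) (h.toSubmodule.mkQ z) = ω (curv D a x (h.toSubmodule.mkQ z)) (h.toSubmodule.mkQ y)) := by
  intro a ha
  have hcomm := curv_mkQ_comm h D hDext hDtf ha
  refine ⟨fun x x' y y' z z' hx hy hz => ?_, fun x y z => ⟨by rw [hcomm], ?_⟩⟩
  · rw [hz, hcomm x y, hx, hcomm y x', hy]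
  · have hskew := curv_skew ω D hDpar a x (h.toSubmodule.mkQ y) (h.toSubmodule.mkQ z)
    have hneg := LinearMap.IsAlt.neg (B := ω) halt (h.toSubmodule.mkQ y)
      (curv D a x (h.toSubmodule.mkQ z))
    linear_combination hskew + hneg
end

section
/- Let (g,h) be a Lie pair of Lie algebras over a field K of characteristic ≠ 2. Then there exists a torsion-free connection on (g,h) extending the h-action, i.e. a K-bilinear map ∇ : g × (g/h) → g/h such that ∇_a p(y) = p([a,y]) for all a ∈ h, y ∈ g, and ∇_x p(y) − ∇_y p(x) = p([x,y]) for all x,y ∈ g. -/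
theorem stmt6 {K : Type*} [Field K] {g : Type*} [LieRing g] [LieAlgebra K g]
    (h2 : (2 : K) ≠ 0) (h : LieSubalgebra K g) :
    ∃ D : g →ₗ[K] (g ⧸ h.toSubmodule) →ₗ[K] (g ⧸ h.toSubmodule),
      (∀ a ∈ h, ∀ y : g, D a (h.toSubmodule.mkQ y) = h.toSubmodule.mkQ ⁅a, y⁆) ∧
      (∀ x y : g, D x (h.toSubmodule.mkQ y) - D y (h.toSubmodule.mkQ x) = h.toSubmodule.mkQ ⁅x, y⁆) := by
  obtain ⟨s, hs⟩ := h.toSubmodule.mkQ.exists_rightInverse_of_surjective h.toSubmodule.range_mkQ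
  set p := h.toSubmodule.mkQ with hp
  have hps (u) : p (s u) = u := LinearMap.congr_fun hs u
  have p_eq_zero {a : g} : p a = 0 ↔ a ∈ h := Submodule.Quotient.mk_eq_zero _
  have vertical_mem (x : g) : x - s (p x) ∈ h := by
    rw [← p_eq_zero, map_sub, hps, sub_self]
  have p_lie_eq_zero {a b : g} (ha : a ∈ h) (hb : b ∈ h) : p ⁅a, b⁆ = 0 :=
    p_eq_zero.2 (h.lie_mem ha hb)
  let D : g →ₗ[K] (g ⧸ h.toSubmodule) →ₗ[K] (g ⧸ h.toSubmodule) :=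
    LinearMap.mk₂ K (fun x u => p ⁅x, s u⁆ - (2 : K)⁻¹ • p ⁅s (p x), s u⁆)
      (fun x x' u => by simp only [map_add, add_lie, smul_add]; abel)
      (fun c x u => by simp only [map_smul, smul_lie, smul_sub, smul_comm c])
      (fun x u u' => by simp only [map_add, lie_add, smul_add]; abel)
      (fun c x u => by simp only [map_smul, lie_smul, smul_sub, smul_comm c])
  have D_apply (x u) : D x u = p ⁅x, s u⁆ - (2 : K)⁻¹ • p ⁅s (p x), s u⁆ := rfl
  refine ⟨D, fun a ha y => ?_, fun x y => ?_⟩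
  · have key := p_lie_eq_zero ha (vertical_mem y)
    rw [lie_sub, map_sub, sub_eq_zero] at key
    simp [D_apply, p_eq_zero.2 ha, key]
  · have key := p_lie_eq_zero (vertical_mem x) (vertical_mem y)
    simp only [lie_sub, sub_lie, map_sub] at key
    have half_add_half (v : g ⧸ h.toSubmodule) : (2 : K)⁻¹ • v + (2 : K)⁻¹ • v = v := by
      rw [← add_smul, ← two_mul, mul_inv_cancel₀ h2, one_smul]
    rw [D_apply, D_apply, ← lie_skew y (s (p x)), ← lie_skew (s (p y)) (s (p x)), map_neg, map_neg,
      smul_neg]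
    have hh := half_add_half (p ⁅s (p x), s (p y)⁆)
    linear_combination (norm := module) -key - hh
end

section
/- Let (g,h) be a Lie pair of Lie algebras over a field K and ∇ a connection on (g,h) extending the h-action, with torsion T and curvature R. The torsion descends to a bilinear map T̄ : (g/h) × (g/h) → g/h with T̄(p(x),p(y)) = T(x,y), and for all a ∈ h and x,y ∈ g: R(a,x)p(y) − R(a,y)p(x) = p([a, t]) − T̄(p([a,x]), p(y)) − T̄(p(x), p([a,y])), where t ∈ g is any lift of T̄(p(x),p(y)) (i.e. p(t) = T(x,y)); in other words, R^∇ − τ_(12)∘R^∇ = ∂^A T̄. -/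
/-- The torsion `D_x p(y) - D_y p(x) - p([x,y])` of a connection `D` on a Lie pair, as a bilinear
map on the ambient Lie algebra. -/
def torsion {K : Type*} [Field K] {g : Type*} [LieRing g] [LieAlgebra K g]
    {Q : Type*} [AddCommGroup Q] [Module K Q] (p : g →ₗ[K] Q)
    (D : g →ₗ[K] Q →ₗ[K] Q) : g →ₗ[K] g →ₗ[K] Q :=
  D.compl₂ p - (D.compl₂ p).flip - (LieModule.toEnd K g g : g →ₗ[K] g →ₗ[K] g).compr₂ p

theorem torsion_apply {K : Type*} [Field K] {g : Type*} [LieRing g] [LieAlgebra K g]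
    {Q : Type*} [AddCommGroup Q] [Module K Q] (p : g →ₗ[K] Q)
    (D : g →ₗ[K] Q →ₗ[K] Q) (x y : g) :
    torsion p D x y = D x (p y) - D y (p x) - p ⁅x, y⁆ := by
  simp [torsion]

/-- A bilinear map vanishing when either argument lies in `N` descends to the quotient by `N`. -/
theorem exists_bilinear_lift_mkQ {R M P : Type*} [CommRing R] [AddCommGroup M] [Module R M]
    [AddCommGroup P] [Module R P] (N : Submodule R M) (B : M →ₗ[R] M →ₗ[R] P)
    (hl : ∀ a ∈ N, ∀ y, B a y = 0) (hr : ∀ a ∈ N, ∀ x, B x a = 0) :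
    ∃ T : (M ⧸ N) →ₗ[R] (M ⧸ N) →ₗ[R] P, ∀ x y, T (N.mkQ x) (N.mkQ y) = B x y := by
  have hB : N ≤ LinearMap.ker B := fun a ha => LinearMap.ext (hl a ha)
  have hC : N ≤ LinearMap.ker (N.liftQ B hB).flip := fun a ha => by
    rw [LinearMap.mem_ker]
    ext x
    simpa using hr a ha x
  exact ⟨(N.liftQ (N.liftQ B hB).flip hC).flip, fun x y => by simp⟩

theorem stmt11 {K : Type*} [Field K] {g : Type*} [LieRing g] [LieAlgebra K g]
    (h : LieSubalgebra K g)
    (D : g →ₗ[K] (g ⧸ h.toSubmodule) →ₗ[K] (g ⧸ h.toSubmodule))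
    (hDext : ∀ a ∈ h, ∀ y : g, D a (h.toSubmodule.mkQ y) = h.toSubmodule.mkQ ⁅a, y⁆) :
    ∃ T : (g ⧸ h.toSubmodule) →ₗ[K] (g ⧸ h.toSubmodule) →ₗ[K] (g ⧸ h.toSubmodule),
      (∀ x y : g, T (h.toSubmodule.mkQ x) (h.toSubmodule.mkQ y) = D x (h.toSubmodule.mkQ y) - D y (h.toSubmodule.mkQ x) - h.toSubmodule.mkQ ⁅x, y⁆) ∧
      (∀ a ∈ h, ∀ x y t : g, h.toSubmodule.mkQ t = T (h.toSubmodule.mkQ x) (h.toSubmodule.mkQ y) →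
        curv D a x (h.toSubmodule.mkQ y) - curv D a y (h.toSubmodule.mkQ x)
          = h.toSubmodule.mkQ ⁅a, t⁆ - T (h.toSubmodule.mkQ ⁅a, x⁆) (h.toSubmodule.mkQ y) - T (h.toSubmodule.mkQ x) (h.toSubmodule.mkQ ⁅a, y⁆)) := by
  obtain ⟨T, hT⟩ := exists_bilinear_lift_mkQ h.toSubmodule (torsion h.toSubmodule.mkQ D)
    (fun a ha y => by
      have hp : h.toSubmodule.mkQ a = 0 := (Submodule.Quotient.mk_eq_zero _).2 ha
      rw [torsion_apply, hDext a ha, hp, map_zero, sub_zero, sub_self])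
    (fun a ha x => by
      have hp : h.toSubmodule.mkQ a = 0 := (Submodule.Quotient.mk_eq_zero _).2 ha
      rw [torsion_apply, hDext a ha, hp, map_zero, ← lie_skew x a, map_neg]
      abel)
  simp only [torsion_apply] at hT
  refine ⟨T, hT, fun a ha x y t ht => ?_⟩
  rw [hT] at ht
  have hD := congrArg (D a) ht
  rw [hDext a ha] at hD
  simp only [map_sub, hDext a ha] at hD
  rw [hD, hT, hT, leibniz_lie a x y, map_add]
  simp only [curv, hDext a ha]
  abel
end

section
/- Let (g,h) be a Lie pair of Lie algebras over a field K and ∇ a torsion-free connection on (g,h) extending the h-action. Then its curvature satisfies R(a,x)p(y) = R(a,y)p(x) for all a ∈ h and x,y ∈ g; i.e. the Atiyah cocycle R^∇(a) is a symmetric bilinear map on g/h for every a ∈ h. -/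
theorem stmt12 {K : Type*} [Field K] {g : Type*} [LieRing g] [LieAlgebra K g]
    (h : LieSubalgebra K g)
    (D : g →ₗ[K] (g ⧸ h.toSubmodule) →ₗ[K] (g ⧸ h.toSubmodule))
    (hDext : ∀ a ∈ h, ∀ y : g, D a (h.toSubmodule.mkQ y) = h.toSubmodule.mkQ ⁅a, y⁆)
    (hDtf : ∀ x y : g, D x (h.toSubmodule.mkQ y) - D y (h.toSubmodule.mkQ x) = h.toSubmodule.mkQ ⁅x, y⁆) :
    ∀ a ∈ h, ∀ x y : g, curv D a x (h.toSubmodule.mkQ y) = curv D a y (h.toSubmodule.mkQ x) := by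
  intro a ha x y
  have e : h.toSubmodule.mkQ ⁅a, ⁅x, y⁆⁆
      = h.toSubmodule.mkQ ⁅⁅a, x⁆, y⁆ + h.toSubmodule.mkQ ⁅x, ⁅a, y⁆⁆ := by
    rw [leibniz_lie, map_add]
  rw [← hDext a ha ⁅x, y⁆, ← hDtf x y, map_sub, ← hDtf ⁅a, x⁆ y, ← hDtf x ⁅a, y⁆] at e
  simp only [curv, hDext a ha x, hDext a ha y]
  rw [← sub_eq_zero] at e ⊢
  rw [← e]
  abel
end

section
/- Let K be a field of characteristic 0, g a finite-dimensional Lie algebra over K, h ⊆ g a Lie subalgebra, ω a nondegenerate alternating bilinear form on g/h with closed pullback (ω(p[x,y],p(z)) + ω(p[y,z],p(x)) + ω(p[z,x],p(y)) = 0 for all x,y,z ∈ g), and ∇ any connection on (g,h) extending the h-action. Then for all a ∈ h and x,y,z ∈ g: ω(R(a,x)p(y), p(z)) − ω(R(a,x)p(z), p(y)) = (∇_{[a,x]}ω)(p(y),p(z)) + (∇_x ω)(p([a,y]), p(z)) + (∇_x ω)(p(y), p([a,z])), where (∇_u ω)(b,b') = −ω(∇_u b, b') − ω(b, ∇_u b')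 and R is the curvature of ∇; in other words, R̃^∇ − τ_(23)∘R̃^∇ = ∂^A(−∇ω). -/
/-- A form on `g ⧸ h` with closed pullback to `g` is `h`-invariant. -/
theorem apply_mkQ_lie_add_eq_zero {K : Type*} [Field K] {g : Type*} [LieRing g] [LieAlgebra K g]
    (h : LieSubalgebra K g)
    (ω : (g ⧸ h.toSubmodule) →ₗ[K] (g ⧸ h.toSubmodule) →ₗ[K] K)
    (halt : ω.IsAlt)
    (hclosed : ∀ x y z : g,
      ω (h.toSubmodule.mkQ ⁅x, y⁆) (h.toSubmodule.mkQ z)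
        + ω (h.toSubmodule.mkQ ⁅y, z⁆) (h.toSubmodule.mkQ x)
        + ω (h.toSubmodule.mkQ ⁅z, x⁆) (h.toSubmodule.mkQ y) = 0)
    {a : g} (ha : a ∈ h) (y z : g) :
    ω (h.toSubmodule.mkQ ⁅a, y⁆) (h.toSubmodule.mkQ z)
      + ω (h.toSubmodule.mkQ y) (h.toSubmodule.mkQ ⁅a, z⁆) = 0 := by
  have hpa : h.toSubmodule.mkQ a = 0 := (Submodule.Quotient.mk_eq_zero _).2 ha
  have hc := hclosed a y z
  rw [hpa, map_zero, add_zero, ← lie_skew z a, map_neg, map_neg, LinearMap.neg_apply,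
    halt.neg] at hc
  exact hc

theorem stmt13 {K : Type*} [Field K] [CharZero K]
    {g : Type*} [LieRing g] [LieAlgebra K g] [FiniteDimensional K g]
    (h : LieSubalgebra K g)
    (ω : (g ⧸ h.toSubmodule) →ₗ[K] (g ⧸ h.toSubmodule) →ₗ[K] K)
    (halt : ∀ b, ω b b = 0)
    (hnd : ∀ b, (∀ b', ω b b' = 0) → b = 0)
    (hclosed : ∀ x y z : g,
      ω (h.toSubmodule.mkQ ⁅x, y⁆) (h.toSubmodule.mkQ z) + ω (h.toSubmodule.mkQ ⁅y, z⁆) (h.toSubmodule.mkQ x) + ω (h.toSubmodule.mkQ ⁅z, x⁆) (h.toSubmodule.mkQ y) = 0)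
    (D : g →ₗ[K] (g ⧸ h.toSubmodule) →ₗ[K] (g ⧸ h.toSubmodule))
    (hDext : ∀ a ∈ h, ∀ y : g, D a (h.toSubmodule.mkQ y) = h.toSubmodule.mkQ ⁅a, y⁆) :
    ∀ a ∈ h, ∀ x y z : g,
      ω (curv D a x (h.toSubmodule.mkQ y)) (h.toSubmodule.mkQ z) - ω (curv D a x (h.toSubmodule.mkQ z)) (h.toSubmodule.mkQ y)
        = (-ω (D ⁅a, x⁆ (h.toSubmodule.mkQ y)) (h.toSubmodule.mkQ z) - ω (h.toSubmodule.mkQ y) (D ⁅a, x⁆ (h.toSubmodule.mkQ z)))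
          + (-ω (D x (h.toSubmodule.mkQ ⁅a, y⁆)) (h.toSubmodule.mkQ z) - ω (h.toSubmodule.mkQ ⁅a, y⁆) (D x (h.toSubmodule.mkQ z)))
          + (-ω (D x (h.toSubmodule.mkQ y)) (h.toSubmodule.mkQ ⁅a, z⁆) - ω (h.toSubmodule.mkQ y) (D x (h.toSubmodule.mkQ ⁅a, z⁆))) := by
  intro a ha x y z
  have hω : ω.IsAlt := halt
  have hinv : ∀ b c, ω (D a b) c = -ω b (D a c) := by
    intro b c
    obtain ⟨u, rfl⟩ := h.toSubmodule.mkQ_surjective b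
    obtain ⟨v, rfl⟩ := h.toSubmodule.mkQ_surjective c
    rw [hDext a ha, hDext a ha]
    exact eq_neg_of_add_eq_zero_left (apply_mkQ_lie_add_eq_zero h ω hω hclosed ha u v)
  simp only [curv, map_sub, LinearMap.sub_apply, hinv, hDext a ha]
  rw [← hω.neg (D x (h.toSubmodule.mkQ z)), ← hω.neg (D x (h.toSubmodule.mkQ ⁅a, z⁆)),
    ← hω.neg (D ⁅a, x⁆ (h.toSubmodule.mkQ z))]
  ring
end

section
/- Let (g,h) be a Lie pair of Lie algebras over a field K, and let ∇ and ∇' be two connections on (g,h), both extending the h-action, with curvatures R and R'. Then their difference descends: there is a (unique) K-bilinear map φ̄ : (g/h) × (g/h) → g/h with φ̄(p(x), b) = ∇_x b − ∇'_x b for all x ∈ g, b ∈ g/h; and for all a ∈ h and x,y ∈ g: R(a,x)p(y) − R'(a,x)p(y) = ∇^A_a(φ̄(p(x),p(y))) − φ̄(p([a,x]), p(y)) − φ̄(p(x), p([a,y])), where ∇^A_a p(w) = p([a,w]); i.e. R^∇ − R^{∇'} = ∂^A φ̄. -/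
theorem stmt15 {K : Type*} [Field K] {g : Type*} [LieRing g] [LieAlgebra K g]
    (h : LieSubalgebra K g)
    (D D' : g →ₗ[K] (g ⧸ h.toSubmodule) →ₗ[K] (g ⧸ h.toSubmodule))
    (hDext : ∀ a ∈ h, ∀ y : g, D a (h.toSubmodule.mkQ y) = h.toSubmodule.mkQ ⁅a, y⁆)
    (hD'ext : ∀ a ∈ h, ∀ y : g, D' a (h.toSubmodule.mkQ y) = h.toSubmodule.mkQ ⁅a, y⁆) :
    (∃! φ : (g ⧸ h.toSubmodule) →ₗ[K] (g ⧸ h.toSubmodule) →ₗ[K] (g ⧸ h.toSubmodule), ∀ (x : g) b, φ (h.toSubmodule.mkQ x) b = D x b - D' x b) ∧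
    (∀ φ : (g ⧸ h.toSubmodule) →ₗ[K] (g ⧸ h.toSubmodule) →ₗ[K] (g ⧸ h.toSubmodule), (∀ (x : g) b, φ (h.toSubmodule.mkQ x) b = D x b - D' x b) →
      ∀ a ∈ h, ∀ x y w : g, h.toSubmodule.mkQ w = φ (h.toSubmodule.mkQ x) (h.toSubmodule.mkQ y) →
        curv D a x (h.toSubmodule.mkQ y) - curv D' a x (h.toSubmodule.mkQ y)
          = h.toSubmodule.mkQ ⁅a, w⁆ - φ (h.toSubmodule.mkQ ⁅a, x⁆) (h.toSubmodule.mkQ y) - φ (h.toSubmodule.mkQ x) (h.toSubmodule.mkQ ⁅a, y⁆)) := by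
  have hDD' : ∀ a ∈ h, ∀ b, D a b = D' a b := by
    intro a ha b
    obtain ⟨y, rfl⟩ := h.toSubmodule.mkQ_surjective b
    rw [hDext a ha, hD'ext a ha]
  refine ⟨⟨h.toSubmodule.liftQ (D - D') ?_, fun x b => ?_, fun ψ hψ => ?_⟩, ?_⟩
  · intro a ha
    refine LinearMap.ext fun b => ?_
    simpa [sub_eq_zero] using hDD' a ha b
  · rfl
  · refine LinearMap.ext fun q => LinearMap.ext fun b => ?_
    obtain ⟨x, rfl⟩ := h.toSubmodule.mkQ_surjective q
    exact hψ x b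
  · intro φ hφ a ha x y w hw
    rw [← hDext a ha w, hw, hφ, hφ, hφ, map_sub, ← hDext a ha y]
    simp only [curv, ← hDD' a ha]
    abel
end

section
/- Let (g,h) be a Lie pair of Lie algebras over a field K and ∇ a connection on (g,h) extending the h-action, with Atiyah cocycle R^∇(a)(p(x),p(y)) = R(a,x)p(y) (well defined since the curvature R vanishes on h × h). Then R^∇ is a Chevalley–Eilenberg 1-cocycle of h with values in the h-module Hom((g/h) ⊗ (g/h), g/h): for all a1, a2 ∈ h and x, y ∈ g, ∇^A_{a1}(R^∇(a2)(p(x),p(y))) − R^∇(a2)(p([a1,x]),p(y)) − R^∇(a2)(p(x),p([a1,y])) − ∇^A_{a2}(R^∇(a1)(p(x),p(y))) + R^∇(a1)(p([a2,x]),p(y)) + R^∇(a1)(p(x),p([a2,y])) − R^∇([a1,a2])(p(x),p(y)) = 0, where ∇^A_a p(w) = p([a,w]). -/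
/-- A connection extending the action of `h` on `g ⧸ h` is flat along `h`. -/
theorem apply_lie_of_extends {K : Type*} [Field K] {g : Type*} [LieRing g] [LieAlgebra K g]
    {h : LieSubalgebra K g}
    {D : g →ₗ[K] (g ⧸ h.toSubmodule) →ₗ[K] (g ⧸ h.toSubmodule)}
    (hDext : ∀ a ∈ h, ∀ y : g, D a (h.toSubmodule.mkQ y) = h.toSubmodule.mkQ ⁅a, y⁆)
    {a₁ a₂ : g} (h₁ : a₁ ∈ h) (h₂ : a₂ ∈ h) (b : g ⧸ h.toSubmodule) :
    D ⁅a₁, a₂⁆ b = D a₁ (D a₂ b) - D a₂ (D a₁ b) := by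
  obtain ⟨y, rfl⟩ := h.toSubmodule.mkQ_surjective b
  rw [hDext _ (h.lie_mem h₁ h₂), hDext _ h₂, hDext _ h₁, hDext _ h₁, hDext _ h₂, lie_lie, map_sub]

theorem stmt16 {K : Type*} [Field K] {g : Type*} [LieRing g] [LieAlgebra K g]
    (h : LieSubalgebra K g)
    (D : g →ₗ[K] (g ⧸ h.toSubmodule) →ₗ[K] (g ⧸ h.toSubmodule))
    (hDext : ∀ a ∈ h, ∀ y : g, D a (h.toSubmodule.mkQ y) = h.toSubmodule.mkQ ⁅a, y⁆) :
    ∀ a₁ ∈ h, ∀ a₂ ∈ h, ∀ x y w₁ w₂ : g,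
      h.toSubmodule.mkQ w₁ = curv D a₂ x (h.toSubmodule.mkQ y) → h.toSubmodule.mkQ w₂ = curv D a₁ x (h.toSubmodule.mkQ y) →
      h.toSubmodule.mkQ ⁅a₁, w₁⁆ - curv D a₂ ⁅a₁, x⁆ (h.toSubmodule.mkQ y) - curv D a₂ x (h.toSubmodule.mkQ ⁅a₁, y⁆)
        - h.toSubmodule.mkQ ⁅a₂, w₂⁆ + curv D a₁ ⁅a₂, x⁆ (h.toSubmodule.mkQ y) + curv D a₁ x (h.toSubmodule.mkQ ⁅a₂, y⁆)
        - curv D ⁅a₁, a₂⁆ x (h.toSubmodule.mkQ y) = 0 := by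
  intro a₁ h₁ a₂ h₂ x y w₁ w₂ hw₁ hw₂
  rw [← hDext a₁ h₁, ← hDext a₂ h₂, ← hDext a₁ h₁, ← hDext a₂ h₂, hw₁, hw₂]
  have jacobi : D ⁅⁅a₁, a₂⁆, x⁆ (h.toSubmodule.mkQ y) =
      D ⁅a₁, ⁅a₂, x⁆⁆ (h.toSubmodule.mkQ y) - D ⁅a₂, ⁅a₁, x⁆⁆ (h.toSubmodule.mkQ y) := by
    rw [lie_lie, map_sub, LinearMap.sub_apply]
  simp only [curv, map_sub, jacobi, apply_lie_of_extends hDext h₁ h₂]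
  abel
end
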